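/- (The Randers part of Corollary 2 of the paper, in coordinates.) Let U ⊆ ℝⁿ (n ≥ 2) be open and connected and let (g, ω) be a Randers datum on U. Suppose (g, ω) is projectively flat in the sense that every forward Randers geodesic of (g, ω) is a forward Randers geodesic of the flat datum (E, 0), where E is the constant identity-matrix field on U and 0 is the zero 1-form (so that the geodesics of (E, 0) are exactly the orientation-preservingly reparameterized straight-line segments). Then ω is closed on U, i.e. (∂ω_i/∂x^k) − (∂ω_k/∂x^i) = 0 at every point of U. -/

import Mathlib

open Matrix

/-- The partial derivative `∂f/∂x^k` of a scalar function on `ℝⁿ` at a point `p`. -/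
noncomputable def dpart {n : ℕ} (f : (Fin n → ℝ) → ℝ) (k : Fin n) (p : Fin n → ℝ) : ℝ :=
  fderiv ℝ f p (Pi.single k 1)

/-- The differential `dω` of a 1-form `ω` (given by its components), as a
skew-symmetric-matrix-valued map: `(dω)_{ik} = ∂ω_i/∂x^k − ∂ω_k/∂x^i`. -/
noncomputable def dform {n : ℕ} (ω : (Fin n → ℝ) → (Fin n → ℝ)) (p : Fin n → ℝ) :
    Matrix (Fin n) (Fin n) ℝ :=
  Matrix.of fun i k => dpart (fun q => ω q i) k p - dpart (fun q => ω q k) i p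

/-- The 1-form `ω` is closed on `U`. -/
def IsClosedFormOn {n : ℕ} (U : Set (Fin n → ℝ)) (ω : (Fin n → ℝ) → (Fin n → ℝ)) : Prop :=
  ∀ p ∈ U, dform ω p = 0

/-- `(g, ω)` is a Randers datum on `U`: `g` is a `C²` field of symmetric positive-definite
matrices and `ω` is a `C²` field of components of a 1-form. -/
def IsRandersDatum {n : ℕ} (U : Set (Fin n → ℝ))
    (g : (Fin n → ℝ) → Matrix (Fin n) (Fin n) ℝ)
    (ω : (Fin n → ℝ) → (Fin n → ℝ)) : Prop :=
  (∀ p ∈ U, (g p).IsSymm ∧ (g p).PosDef) ∧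
  (∀ i j, ContDiffOn ℝ 2 (fun q => g q i j) U) ∧
  (∀ i, ContDiffOn ℝ 2 (fun q => ω q i) U)

/-- `x : I → U` is a forward Randers geodesic of `(g, ω)`: `I` is an open interval, `x` is a
`C²` curve in `U` with nowhere-vanishing derivative satisfying the Euler–Lagrange equation of
the Randers length functional. -/
def IsRandersGeodesic {n : ℕ} (U : Set (Fin n → ℝ))
    (g : (Fin n → ℝ) → Matrix (Fin n) (Fin n) ℝ)
    (ω : (Fin n → ℝ) → (Fin n → ℝ))
    (I : Set ℝ) (x : ℝ → (Fin n → ℝ)) : Prop :=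
  IsOpen I ∧ I.OrdConnected ∧ (∀ t ∈ I, x t ∈ U) ∧
  ContDiffOn ℝ 2 x I ∧ (∀ t ∈ I, deriv x t ≠ 0) ∧
  ∀ t ∈ I, ∀ j : Fin n,
    deriv (deriv x) t j / Real.sqrt (∑ k, ∑ m, g (x t) k m * deriv x t k * deriv x t m)
    + deriv x t j *
        deriv (fun s => 1 / Real.sqrt (∑ k, ∑ m, g (x s) k m * deriv x s k * deriv x s m)) t
    + (1 / Real.sqrt (∑ k, ∑ m, g (x t) k m * deriv x t k * deriv x t m)) *
        ∑ i, ∑ k, ∑ p, (g (x t))⁻¹ j i * dpart (fun q => g q i p) k (x t) *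
          deriv x t k * deriv x t p
    + ∑ i, ∑ k, (g (x t))⁻¹ j i *
        (dpart (fun q => ω q i) k (x t) - dpart (fun q => ω q k) i (x t)) * deriv x t k
    - (1 / (2 * Real.sqrt (∑ k, ∑ m, g (x t) k m * deriv x t k * deriv x t m))) *
        ∑ i, ∑ p, ∑ q, (g (x t))⁻¹ j i * dpart (fun r => g r p q) i (x t) *
          deriv x t p * deriv x t q
    = 0

/-- The derivative of `f` in direction `u` in terms of partial derivatives. -/
theorem fderiv_apply_eq_sum_dpart {n : ℕ} (f : (Fin n → ℝ) → ℝ) (p u : Fin n → ℝ) :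
    fderiv ℝ f p u = ∑ l, dpart f l p * u l := by
  conv_lhs => rw [pi_eq_sum_univ' u]
  simp [dpart, mul_comm]

theorem ContDiffAt.dpart {n : ℕ} {f : (Fin n → ℝ) → ℝ} {p : Fin n → ℝ}
    (hf : ContDiffAt ℝ 2 f p) (k : Fin n) : ContDiffAt ℝ 1 (_root_.dpart f k) p :=
  (hf.fderiv_right (by norm_num)).clm_apply contDiffAt_const

section PairCurves

variable {E F : Type*} [NormedAddCommGroup E] [NormedSpace ℝ E] [NormedAddCommGroup F]
  [NormedSpace ℝ F] {α : ℝ → E × F} {α' : E × F} {t : ℝ}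

theorem HasDerivAt.fst_comp (h : HasDerivAt α α' t) : HasDerivAt (fun s => (α s).1) α'.1 t :=
  (hasFDerivAt_fst (𝕜 := ℝ) (p := α t)).comp_hasDerivAt t h

theorem HasDerivAt.snd_comp (h : HasDerivAt α α' t) : HasDerivAt (fun s => (α s).2) α'.2 t :=
  (hasFDerivAt_snd (𝕜 := ℝ) (p := α t)).comp_hasDerivAt t h

/-- Local solvability of the second-order equation `x'' = A (x, x')`. -/
theorem ContDiffAt.exists_second_order_solution [CompleteSpace E] {A : E × E → E} {p v : E}
    (hA : ContDiffAt ℝ 1 A (p, v)) {U : Set E} (hU : U ∈ nhds p) :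
    ∃ ε > 0, ∃ x u : ℝ → E, x 0 = p ∧ u 0 = v ∧ ∀ t ∈ Metric.ball (0 : ℝ) ε,
      HasDerivAt x (u t) t ∧ HasDerivAt u (A (x t, u t)) t ∧ x t ∈ U := by
  have hF : ContDiffAt ℝ 1 (fun z : E × E => (z.2, A z)) (p, v) := contDiffAt_snd.prodMk hA
  obtain ⟨α, hα0, ε, hε, hα⟩ :=
    hF.exists_forall_mem_closedBall_exists_eq_forall_mem_Ioo_hasDerivAt₀ 0
  rw [← Real.ball_eq_Ioo] at hα
  have hα_cont : ContinuousAt (fun t => (α t).1) 0 :=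
    (hα 0 (Metric.mem_ball_self hε)).fst_comp.continuousAt
  have hmem : ∀ᶠ t in nhds (0 : ℝ), (α t).1 ∈ U :=
    hα_cont.preimage_mem_nhds (by simpa only [hα0] using hU)
  obtain ⟨δ, hδ, hball⟩ := Metric.eventually_nhds_iff_ball.1 hmem
  refine ⟨min ε δ, lt_min hε hδ, fun t => (α t).1, fun t => (α t).2, by simp [hα0],
    by simp [hα0], fun t ht => ?_⟩
  have hd := hα t (Metric.ball_subset_ball (min_le_left _ _) ht)
  exact ⟨hd.fst_comp, hd.snd_comp, hball t (Metric.ball_subset_ball (min_le_right _ _) ht)⟩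

end PairCurves

section MatrixSmoothness

variable {E ι : Type*} [NormedAddCommGroup E] [NormedSpace ℝ E] [Fintype ι] [DecidableEq ι]
  {r : WithTop ℕ∞} {M : E → Matrix ι ι ℝ} {x : E}

theorem ContDiffAt.matrix_det (hM : ∀ i j, ContDiffAt ℝ r (fun y => M y i j) x) :
    ContDiffAt ℝ r (fun y => (M y).det) x := by
  simp only [Matrix.det_apply']
  exact ContDiffAt.sum fun σ _ => contDiffAt_const.mul (contDiffAt_prod fun i _ => hM _ _)

theorem ContDiffAt.matrix_inv_apply (hM : ∀ i j, ContDiffAt ℝ r (fun y => M y i j) x)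
    (hx : (M x).det ≠ 0) (i j : ι) : ContDiffAt ℝ r (fun y => (M y)⁻¹ i j) x := by
  simp only [Matrix.inv_def, Matrix.smul_apply, smul_eq_mul, Ring.inverse_eq_inv',
    Matrix.adjugate_apply]
  refine ((ContDiffAt.matrix_det hM).inv hx).mul (ContDiffAt.matrix_det fun k l => ?_)
  by_cases h : k = j
  · subst h
    simpa using contDiffAt_const
  · simpa [Matrix.updateRow_ne h] using hM k l

end MatrixSmoothness

section RandersGeodesics

variable {n : ℕ} (g : (Fin n → ℝ) → Matrix (Fin n) (Fin n) ℝ) (ω : (Fin n → ℝ) → (Fin n → ℝ))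

/-- The covector `∂_k g_{ip} u^k u^p + c (dω)_{ik} u^k - ½ ∂_i g_{pq} u^p u^q`. -/
noncomputable def randersForce (c : ℝ) (x u : Fin n → ℝ) : Fin n → ℝ := fun i =>
  ∑ k, ∑ p, dpart (fun q => g q i p) k x * u k * u p + c * ∑ k, dform ω x i k * u k
    - 1 / 2 * ∑ p, ∑ q, dpart (fun r => g r p q) i x * u p * u q

/-- The acceleration of a Randers geodesic of constant `g`-speed `c`. -/
noncomputable def randersAccel (c : ℝ) (x u : Fin n → ℝ) : Fin n → ℝ :=
  -((g x)⁻¹ *ᵥ randersForce g ω c x u)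

/-- The squared `g`-length of the tangent vector `u` at `x`. -/
def metricSq (x u : Fin n → ℝ) : ℝ := ∑ k, ∑ m, g x k m * u k * u m

variable {g ω}

theorem IsRandersDatum.contDiffAt_metric {U : Set (Fin n → ℝ)} (h : IsRandersDatum U g ω)
    (hU : IsOpen U) {p : Fin n → ℝ} (hp : p ∈ U) (i j : Fin n) :
    ContDiffAt ℝ 2 (fun q => g q i j) p :=
  (h.2.1 i j).contDiffAt (hU.mem_nhds hp)

theorem IsRandersDatum.contDiffAt_form {U : Set (Fin n → ℝ)} (h : IsRandersDatum U g ω)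
    (hU : IsOpen U) {p : Fin n → ℝ} (hp : p ∈ U) (i : Fin n) :
    ContDiffAt ℝ 2 (fun q => ω q i) p :=
  (h.2.2 i).contDiffAt (hU.mem_nhds hp)

theorem IsRandersDatum.contDiffAt_randersAccel {U : Set (Fin n → ℝ)}
    (h : IsRandersDatum U g ω) (hU : IsOpen U) (c : ℝ) {p : Fin n → ℝ} (hp : p ∈ U)
    (v : Fin n → ℝ) :
    ContDiffAt ℝ 1 (fun z : (Fin n → ℝ) × (Fin n → ℝ) => randersAccel g ω c z.1 z.2) (p, v) := by
  have hu (k : Fin n) :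
      ContDiffAt ℝ 1 (fun z : (Fin n → ℝ) × (Fin n → ℝ) => z.2 k) (p, v) := by fun_prop
  have lift {f : (Fin n → ℝ) → ℝ} (hf : ContDiffAt ℝ 1 f p) :
      ContDiffAt ℝ 1 (fun z : (Fin n → ℝ) × (Fin n → ℝ) => f z.1) (p, v) :=
    ContDiffAt.comp (p, v) hf contDiffAt_fst
  have hg (i j k : Fin n) := lift ((h.contDiffAt_metric hU hp i j).dpart k)
  have hω (i k : Fin n) := lift ((h.contDiffAt_form hU hp i).dpart k)
  have hinv (i j : Fin n) := lift (ContDiffAt.matrix_inv_apply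
    (fun i j => (h.contDiffAt_metric hU hp i j).of_le one_le_two) (h.1 p hp).2.det_pos.ne' i j)
  refine contDiffAt_pi.2 fun j => ?_
  simp only [randersAccel, Pi.neg_apply, Matrix.mulVec, dotProduct, randersForce, dform,
    Matrix.of_apply]
  refine (ContDiffAt.sum fun i _ => (hinv j i).mul (((ContDiffAt.sum fun k _ =>
    ContDiffAt.sum fun q _ => ((hg i q k).mul (hu k)).mul (hu q)).add
    (contDiffAt_const.mul (ContDiffAt.sum fun k _ => ((hω i k).sub (hω k i)).mul (hu k)))).sub
    (contDiffAt_const.mul (ContDiffAt.sum fun k _ => ContDiffAt.sum fun q _ =>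
      ((hg k q i).mul (hu k)).mul (hu q))))).neg

theorem metricSq_eq_dotProduct (x u : Fin n → ℝ) : metricSq g x u = u ⬝ᵥ g x *ᵥ u := by
  simp only [metricSq, dotProduct, Matrix.mulVec, Finset.mul_sum]
  exact Finset.sum_congr rfl fun k _ => Finset.sum_congr rfl fun m _ => by ring

theorem IsRandersDatum.metricSq_pos {U : Set (Fin n → ℝ)} (h : IsRandersDatum U g ω)
    {p v : Fin n → ℝ} (hp : p ∈ U) (hv : v ≠ 0) : 0 < metricSq g p v := by
  rw [metricSq_eq_dotProduct]
  simpa using (h.1 p hp).2.dotProduct_mulVec_pos hv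

theorem dotProduct_dform_mulVec_self (x u : Fin n → ℝ) : u ⬝ᵥ dform ω x *ᵥ u = 0 := by
  have hskew : (dform ω x)ᵀ = -dform ω x := by
    ext i k
    simp [dform]
  have h : u ⬝ᵥ dform ω x *ᵥ u = -(u ⬝ᵥ dform ω x *ᵥ u) := by
    conv_lhs => rw [Matrix.dotProduct_mulVec, ← Matrix.mulVec_transpose, hskew, dotProduct_comm,
      Matrix.neg_mulVec, dotProduct_neg]
  linarith

/-- The magnetic force `dω` does no work, so only half of the metric term survives. -/
theorem dotProduct_randersForce (c : ℝ) (x u : Fin n → ℝ) :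
    u ⬝ᵥ randersForce g ω c x u
      = 1 / 2 * ∑ k, ∑ m, (∑ l, dpart (fun q => g q k m) l x * u l) * u k * u m := by
  have hform : ∑ i, u i * (c * ∑ k, dform ω x i k * u k) = 0 := by
    have h := dotProduct_dform_mulVec_self (ω := ω) x u
    simp only [dotProduct, Matrix.mulVec] at h
    simp only [mul_left_comm _ c, ← Finset.mul_sum, h, mul_zero]
  have h₁ : ∑ i, u i * ∑ k, ∑ p, dpart (fun q => g q i p) k x * u k * u p
      = ∑ k, ∑ m, (∑ l, dpart (fun q => g q k m) l x * u l) * u k * u m := by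
    refine Finset.sum_congr rfl fun i _ => ?_
    rw [Finset.sum_comm, Finset.mul_sum]
    refine Finset.sum_congr rfl fun m _ => ?_
    simp only [Finset.mul_sum, Finset.sum_mul]
    exact Finset.sum_congr rfl fun l _ => by ring
  have h₂ : ∑ i, u i * (1 / 2 * ∑ p, ∑ q, dpart (fun r => g r p q) i x * u p * u q)
      = 1 / 2 * ∑ k, ∑ m, (∑ l, dpart (fun q => g q k m) l x * u l) * u k * u m := by
    simp only [mul_left_comm _ (1 / 2 : ℝ), ← Finset.mul_sum]
    congr 1
    simp only [Finset.mul_sum, Finset.sum_mul]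
    rw [Finset.sum_comm]
    refine Finset.sum_congr rfl fun k _ => ?_
    rw [Finset.sum_comm]
    exact Finset.sum_congr rfl fun m _ => Finset.sum_congr rfl fun l _ => by ring
  simp only [dotProduct, randersForce, mul_sub, mul_add, Finset.sum_sub_distrib,
    Finset.sum_add_distrib]
  rw [hform, h₁, h₂]
  ring

theorem IsRandersDatum.mulVec_randersAccel {U : Set (Fin n → ℝ)} (h : IsRandersDatum U g ω)
    (c : ℝ) {p : Fin n → ℝ} (hp : p ∈ U) (u : Fin n → ℝ) :
    g p *ᵥ randersAccel g ω c p u = -randersForce g ω c p u := by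
  rw [randersAccel, Matrix.mulVec_neg, Matrix.mulVec_mulVec,
    Matrix.mul_nonsing_inv _ (h.1 p hp).2.det_pos.ne'.isUnit, Matrix.one_mulVec]

/-- The `g`-speed is a first integral of the geodesic equation. -/
theorem IsRandersDatum.hasDerivAt_metricSq {U : Set (Fin n → ℝ)} (h : IsRandersDatum U g ω)
    (hU : IsOpen U) {c t : ℝ} {x u : ℝ → (Fin n → ℝ)} (hxU : x t ∈ U)
    (hx : HasDerivAt x (u t) t) (hu : HasDerivAt u (randersAccel g ω c (x t) (u t)) t) :
    HasDerivAt (fun s => metricSq g (x s) (u s)) 0 t := by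
  set a := randersAccel g ω c (x t) (u t) with ha
  have hg (k m : Fin n) : HasDerivAt (fun s => g (x s) k m)
      (∑ l, dpart (fun q => g q k m) l (x t) * u t l) t := by
    rw [← fderiv_apply_eq_sum_dpart]
    exact ((h.contDiffAt_metric hU hxU k m).differentiableAt
      two_ne_zero).hasFDerivAt.comp_hasDerivAt t hx
  have hu' := hasDerivAt_pi.1 hu
  have hN := HasDerivAt.fun_sum (u := Finset.univ) fun k _ =>
    HasDerivAt.fun_sum (u := Finset.univ) fun m _ => ((hg k m).fun_mul (hu' k)).fun_mul (hu' m)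
  refine hN.congr_deriv ?_
  have hga : u t ⬝ᵥ g (x t) *ᵥ a = -(u t ⬝ᵥ randersForce g ω c (x t) (u t)) := by
    rw [ha, h.mulVec_randersAccel c hxU, dotProduct_neg]
  have hga' : a ⬝ᵥ g (x t) *ᵥ u t = u t ⬝ᵥ g (x t) *ᵥ a := by
    rw [Matrix.dotProduct_mulVec, ← Matrix.mulVec_transpose, (h.1 _ hxU).1.eq, dotProduct_comm]
  have e₁ : ∑ k, ∑ m, g (x t) k m * u t k * a m = u t ⬝ᵥ g (x t) *ᵥ a := by
    simp only [dotProduct, Matrix.mulVec, Finset.mul_sum]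
    exact Finset.sum_congr rfl fun k _ => Finset.sum_congr rfl fun m _ => by ring
  have e₂ : ∑ k, ∑ m, g (x t) k m * a k * u t m = a ⬝ᵥ g (x t) *ᵥ u t := by
    simp only [dotProduct, Matrix.mulVec, Finset.mul_sum]
    exact Finset.sum_congr rfl fun k _ => Finset.sum_congr rfl fun m _ => by ring
  rw [dotProduct_randersForce] at hga
  simp only [add_mul, Finset.sum_add_distrib]
  rw [e₁, e₂, hga', hga]
  ring

/-- A curve of constant `g`-speed `c > 0` whose acceleration is `randersAccel g ω c` is a
forward Randers geodesic. -/
theorem IsRandersDatum.isRandersGeodesic {U : Set (Fin n → ℝ)} (h : IsRandersDatum U g ω)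
    (hU : IsOpen U) {c : ℝ} (hc : 0 < c) {I : Set ℝ} (hI : IsOpen I) (hI' : I.OrdConnected)
    {x u : ℝ → (Fin n → ℝ)} (hxU : ∀ t ∈ I, x t ∈ U) (hx : ∀ t ∈ I, HasDerivAt x (u t) t)
    (hu : ∀ t ∈ I, HasDerivAt u (randersAccel g ω c (x t) (u t)) t)
    (hN : ∀ t ∈ I, metricSq g (x t) (u t) = c ^ 2) : IsRandersGeodesic U g ω I x := by
  have hdx : Set.EqOn (deriv x) u I := fun t ht => (hx t ht).deriv
  have hddx (t : ℝ) (ht : t ∈ I) : deriv (deriv x) t = randersAccel g ω c (x t) (u t) := by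
    rw [(hdx.eventuallyEq_of_mem (hI.mem_nhds ht)).deriv_eq, (hu t ht).deriv]
  have hcont : ContinuousOn (deriv u) I := by
    intro t ht
    have hacc := (h.contDiffAt_randersAccel hU c (hxU t ht) (u t)).continuousAt
    have : ContinuousAt (fun s => randersAccel g ω c (x s) (u s)) t :=
      ContinuousAt.comp (f := fun s => (x s, u s)) hacc
        ((hx t ht).continuousAt.prodMk (hu t ht).continuousAt)
    exact (this.continuousWithinAt).congr (fun s hs => (hu s hs).deriv) (hu t ht).deriv
  have hu1 : ContDiffOn ℝ 1 u I := by
    rw [show (1 : WithTop ℕ∞) = 0 + 1 from rfl, contDiffOn_succ_iff_deriv_of_isOpen hI]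
    exact ⟨fun t ht => (hu t ht).differentiableAt.differentiableWithinAt, by simp,
      contDiffOn_zero.2 hcont⟩
  have hx2 : ContDiffOn ℝ 2 x I := by
    rw [show (2 : WithTop ℕ∞) = 1 + 1 by norm_num, contDiffOn_succ_iff_deriv_of_isOpen hI]
    exact ⟨fun t ht => (hx t ht).differentiableAt.differentiableWithinAt, by simp,
      hu1.congr hdx⟩
  have hsqrt (t : ℝ) (ht : t ∈ I) :
      √(∑ k, ∑ m, g (x t) k m * deriv x t k * deriv x t m) = c := by
    rw [hdx ht]
    exact (congrArg Real.sqrt (hN t ht)).trans (Real.sqrt_sq hc.le)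
  refine ⟨hI, hI', hxU, hx2, fun t ht h0 => ?_, fun t ht j => ?_⟩
  · have hN0 := hN t ht
    simp only [← hdx ht, h0, metricSq, Pi.zero_apply, mul_zero, Finset.sum_const_zero] at hN0
    exact (pow_pos hc 2).ne hN0
  · have hconst : deriv (fun s => 1 / √(∑ k, ∑ m, g (x s) k m * deriv x s k * deriv x s m)) t
        = 0 := by
      have : (fun s => 1 / √(∑ k, ∑ m, g (x s) k m * deriv x s k * deriv x s m))
          =ᶠ[nhds t] fun _ => 1 / c := by
        filter_upwards [hI.mem_nhds ht] with s hs
        rw [hsqrt s hs]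
      rw [this.deriv_eq, deriv_const]
    rw [hconst, hsqrt t ht, hddx t ht, hdx ht]
    simp only [randersAccel, randersForce, dform, Matrix.of_apply, Pi.neg_apply, Matrix.mulVec,
      dotProduct, mul_assoc, ← Finset.mul_sum]
    simp only [mul_sub ((g (x t))⁻¹ j _), mul_add ((g (x t))⁻¹ j _), Finset.sum_add_distrib,
      Finset.sum_sub_distrib, mul_left_comm ((g (x t))⁻¹ j _) c,
      mul_left_comm ((g (x t))⁻¹ j _) (1 / 2), ← Finset.mul_sum]
    field_simp
    ring

/-- Local existence of constant-speed forward Randers geodesics. -/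
theorem IsRandersDatum.exists_isRandersGeodesic {U : Set (Fin n → ℝ)}
    (h : IsRandersDatum U g ω) (hU : IsOpen U) {p v : Fin n → ℝ} (hp : p ∈ U) (hv : v ≠ 0) :
    ∃ (I : Set ℝ) (x : ℝ → (Fin n → ℝ)), IsRandersGeodesic U g ω I x ∧ 0 ∈ I ∧
      deriv x 0 = v ∧ deriv (deriv x) 0 = randersAccel g ω (√(metricSq g p v)) p v := by
  have hpos := h.metricSq_pos hp hv
  set c := √(metricSq g p v) with hc
  obtain ⟨ε, hε, x, u, hx0, hu0, hsub⟩ :=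
    (h.contDiffAt_randersAccel hU c hp v).exists_second_order_solution (hU.mem_nhds hp)
  have h0 : (0 : ℝ) ∈ Metric.ball (0 : ℝ) ε := Metric.mem_ball_self hε
  have hNderiv (t : ℝ) (ht : t ∈ Metric.ball (0 : ℝ) ε) :=
    h.hasDerivAt_metricSq hU (hsub t ht).2.2 (hsub t ht).1 (hsub t ht).2.1
  have hN (t : ℝ) (ht : t ∈ Metric.ball (0 : ℝ) ε) :
      metricSq g (x t) (u t) = c ^ 2 := by
    rw [Metric.isOpen_ball.is_const_of_deriv_eq_zero (convex_ball 0 _).isPreconnected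
      (fun s hs => (hNderiv s hs).differentiableAt.differentiableWithinAt)
      (fun s hs => (hNderiv s hs).deriv) ht h0, hx0, hu0, hc, Real.sq_sqrt hpos.le]
  refine ⟨Metric.ball 0 ε, x,
    h.isRandersGeodesic hU (Real.sqrt_pos.2 hpos) Metric.isOpen_ball
      (convex_ball 0 _).ordConnected (fun t ht => (hsub t ht).2.2) (fun t ht => (hsub t ht).1)
      (fun t ht => (hsub t ht).2.1) hN, h0, ?_, ?_⟩
  · rw [(hsub 0 h0).1.deriv, hu0]
  · have hev : deriv x =ᶠ[nhds 0] u := by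
      filter_upwards [Metric.isOpen_ball.mem_nhds h0] with t ht using (hsub t ht).1.deriv
    rw [hev.deriv_eq, (hsub 0 h0).2.1.deriv, hx0, hu0]

/-- Geodesics of the flat datum have acceleration parallel to the velocity. -/
theorem IsRandersGeodesic.exists_deriv_deriv_eq_smul {U : Set (Fin n → ℝ)} {I : Set ℝ}
    {x : ℝ → (Fin n → ℝ)}
    (hx : IsRandersGeodesic U (fun _ => (1 : Matrix (Fin n) (Fin n) ℝ))
      (fun _ => (0 : Fin n → ℝ)) I x) {t : ℝ} (ht : t ∈ I) :
    ∃ a : ℝ, deriv (deriv x) t = a • deriv x t := by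
  obtain ⟨-, -, -, -, hne, hEL⟩ := hx
  have hpos : 0 < √(∑ k, ∑ m, (1 : Matrix (Fin n) (Fin n) ℝ) k m * deriv x t k * deriv x t m) := by
    have h := (Matrix.PosDef.one (n := Fin n) (R := ℝ)).dotProduct_mulVec_pos (hne t ht)
    rw [star_trivial, ← metricSq_eq_dotProduct (g := fun _ => 1) (x t)] at h
    exact Real.sqrt_pos.2 h
  refine ⟨-(√(∑ k, ∑ m, (1 : Matrix (Fin n) (Fin n) ℝ) k m * deriv x t k * deriv x t m) *
    deriv (fun s => 1 / √(∑ k, ∑ m,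
      (1 : Matrix (Fin n) (Fin n) ℝ) k m * deriv x s k * deriv x s m)) t), funext fun j => ?_⟩
  have hj := hEL t ht j
  simp only [dpart, fderiv_fun_const, Pi.zero_apply, _root_.zero_apply, mul_zero,
    zero_mul, Finset.sum_const_zero, sub_zero, add_zero] at hj
  simp only [Pi.smul_apply, smul_eq_mul]
  field_simp at hj
  linarith

/-- Reversing the velocity changes the sign of the `dω` term only. -/
theorem randersForce_sub_randersForce_neg (c : ℝ) (x u : Fin n → ℝ) :
    randersForce g ω c x u - randersForce g ω c x (-u) = (2 * c) • dform ω x *ᵥ u := by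
  ext i
  simp only [randersForce, Pi.sub_apply, Pi.neg_apply, mul_neg, neg_mul, neg_neg,
    Finset.sum_neg_distrib, Pi.smul_apply, smul_eq_mul, Matrix.mulVec, dotProduct]
  ring

theorem metricSq_neg (x u : Fin n → ℝ) : metricSq g x (-u) = metricSq g x u := by
  simp [metricSq]

end RandersGeodesics

/-- The Randers part of Corollary 2 of the paper: if every forward Randers geodesic of
`(g, ω)` is a forward Randers geodesic of the flat datum (identity metric, zero 1-form),
then `ω` is closed. -/
theorem stmt_17 (n : ℕ) (hn : 2 ≤ n) (U : Set (Fin n → ℝ))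
    (hUopen : IsOpen U) (hUconn : IsConnected U)
    (g : (Fin n → ℝ) → Matrix (Fin n) (Fin n) ℝ)
    (ω : (Fin n → ℝ) → (Fin n → ℝ))
    (hdatum : IsRandersDatum U g ω)
    (hflat : ∀ (I : Set ℝ) (x : ℝ → (Fin n → ℝ)),
      IsRandersGeodesic U g ω I x →
        IsRandersGeodesic U (fun _ => (1 : Matrix (Fin n) (Fin n) ℝ))
          (fun _ => (0 : Fin n → ℝ)) I x) :
    IsClosedFormOn U ω := by
  have hmul (p : Fin n → ℝ) (hp : p ∈ U) (v : Fin n → ℝ) : dform ω p *ᵥ v = 0 := by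
    rcases eq_or_ne v 0 with rfl | hv
    · simp
    have hpos := hdatum.metricSq_pos hp hv
    have key (w : Fin n → ℝ) (hw : w ≠ 0) :
        ∃ a : ℝ, randersForce g ω (√(metricSq g p w)) p w = a • g p *ᵥ w := by
      obtain ⟨I, x, hgeo, h0, hx1, hx2⟩ := hdatum.exists_isRandersGeodesic hUopen hp hw
      obtain ⟨a, ha⟩ := (hflat I x hgeo).exists_deriv_deriv_eq_smul h0
      rw [hx1, hx2] at ha
      refine ⟨-a, ?_⟩
      rw [← neg_eq_iff_eq_neg.2 (hdatum.mulVec_randersAccel _ hp w), ha, Matrix.mulVec_smul,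
        neg_smul]
    obtain ⟨a, ha⟩ := key v hv
    obtain ⟨b, hb⟩ := key (-v) (neg_ne_zero.2 hv)
    have hsub := randersForce_sub_randersForce_neg (g := g) (ω := ω) (√(metricSq g p v)) p v
    rw [metricSq_neg] at hb
    rw [ha, hb, Matrix.mulVec_neg, smul_neg, sub_neg_eq_add, ← add_smul] at hsub
    have hab : a + b = 0 := by
      have hdot := congrArg (fun y => v ⬝ᵥ y) hsub
      simp only [dotProduct_smul, dotProduct_dform_mulVec_self, ← metricSq_eq_dotProduct (g := g),
        smul_eq_mul, mul_zero] at hdot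
      exact (mul_eq_zero.1 hdot).resolve_right hpos.ne'
    rw [hab, zero_smul] at hsub
    exact (smul_eq_zero.1 hsub.symm).resolve_left
      (mul_pos two_pos (Real.sqrt_pos.2 hpos)).ne'
  intro p hp
  exact Matrix.ext_of_mulVec_single fun i => by rw [hmul p hp, Matrix.zero_mulVec]
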